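/- arXiv:1311.4502 — 2 statements merged into one kernel-verified Lean document; each statement's English description precedes it below -/
import Mathlib

section
/- Let n ≥ 1 be an integer and let a, c ∈ ℂ. Set w = −an/(2a+2c+n−2), and assume 2a+2c+n−2 ≠ 0, a ≠ 0, w + j ≠ 0 for 0 ≤ j ≤ ⌊n/2⌋−1, c + j ≠ 0 for 0 ≤ j ≤ n−2, and 2−c−n+j ≠ 0 for 0 ≤ j ≤ ⌊n/2⌋−1. Then Σ_{k=0}^{⌊n/2⌋} (−n/2)_k ((1−n)/2)_k (1+w)_k (a)_k (−a)_k / ((1/2)_k (w)_k (c)_k (2−c−n)_k · k!) = (c−a)_{n−1}/(c)_{n−1}. (Terminating balanced ₅F₄-series identity; the left-hand side is ₅F₄[−n/2, (1−n)/2, 1−an/(2a+2c+n−2), a, −a; 1/2, −an/(2a+2c+n−2), c, 2−c−n; 1].) -/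
/-- Rising factorial (Pochhammer symbol) of a complex number:
`poch x 0 = 1` and `poch x (m+1) = poch x m * (x + m)`. -/
noncomputable def poch (x : ℂ) : ℕ → ℂ
  | 0 => 1
  | m + 1 => poch x m * (x + (m : ℂ))

/-- `∏_{j<k} (a² - (j+1)²)` -/
noncomputable def qq (a : ℂ) : ℕ → ℂ
  | 0 => 1
  | k + 1 => qq a k * (a ^ 2 - ((k : ℂ) + 1) ^ 2)

/-- `∏_{j<k} (a² - j²)` -/
noncomputable def pp (a : ℂ) : ℕ → ℂ
  | 0 => 1
  | k + 1 => a ^ 2 * qq a k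

noncomputable def ee (c : ℂ) (m k : ℕ) : ℂ := (m.choose (2 * k) : ℂ) * poch (c + k) (m - 2 * k)

noncomputable def oo (c : ℂ) (m k : ℕ) : ℂ :=
  if m = 2 * k + 1 then 1 else
    (m.choose (2 * k + 1) : ℂ) * ((c + ((m : ℂ) - 1) / 2) * poch (c + k + 1) (m - (2 * k + 2)))

theorem poch_succ_left (x : ℂ) (m : ℕ) : poch x (m + 1) = x * poch (x + 1) m := by
  induction m with
  | zero => simp [poch]
  | succ m ih =>
    rw [poch, ih, poch]; push_cast; ring

theorem pp_succ (a : ℂ) (k : ℕ) : pp a (k + 1) = qq a (k + 1) + ((k : ℂ) + 1) ^ 2 * qq a k := by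
  simp only [pp, qq]; ring

theorem choose_step (m k r : ℕ) (h : m = k + 1 + r) :
    (m.choose (k + 1) : ℂ) = m.choose k * ((r : ℂ) + 1) / ((k : ℂ) + 1) := by
  have h1 := Nat.choose_succ_right_eq m k
  have h2 : m - k = r + 1 := by omega
  rw [h2] at h1
  have h3 : (m.choose (k + 1) : ℂ) * ((k : ℂ) + 1) = m.choose k * ((r : ℂ) + 1) := by exact_mod_cast h1
  have : (k : ℂ) + 1 ≠ 0 := by exact_mod_cast Nat.succ_ne_zero k
  field_simp
  exact h3

theorem ee_rec_zero (c : ℂ) (m : ℕ) : ee c (m + 1) 0 = (c + m) * ee c m 0 := by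
  simp [ee, poch]; ring

theorem ee_rec (c : ℂ) (m k : ℕ) :
    ee c (m + 1) (k + 1) = (c + m) * ee c m (k + 1) + oo c m k := by
  rcases lt_trichotomy m (2 * k + 1) with h | h | h
  · have h1 : (m + 1).choose (2 * (k + 1)) = 0 := Nat.choose_eq_zero_of_lt (by omega)
    have h2 : m.choose (2 * (k + 1)) = 0 := Nat.choose_eq_zero_of_lt (by omega)
    have h3 : m.choose (2 * k + 1) = 0 := Nat.choose_eq_zero_of_lt (by omega)
    simp [ee, oo, h1, h2, h3, h.ne]
  · have h2 : m.choose (2 * (k + 1)) = 0 := Nat.choose_eq_zero_of_lt (by omega)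
    have h3 : m + 1 = 2 * (k + 1) := by omega
    simp only [ee, oo, h2, h3, if_pos h]
    simp [poch]
  · obtain ⟨r, rfl⟩ := Nat.exists_eq_add_of_lt h
    have e1 : 2 * k + 1 + r + 1 + 1 - 2 * (k + 1) = r + 1 := by omega
    have e2 : 2 * k + 1 + r + 1 - 2 * (k + 1) = r := by omega
    have e3 : 2 * k + 1 + r + 1 - (2 * k + 2) = r := by omega
    have e4 : 2 * (k + 1) = 2 * k + 1 + 1 := by ring
    rw [ee, ee, oo, if_neg (by omega), e1, e2, e3, poch, e4, Nat.choose_succ_succ' (2 * k + 1 + r + 1)]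
    have c1 := choose_step (2 * k + 1 + r + 1) (2 * k + 1) r (by ring)
    push_cast
    rw [c1]
    have : (2 * (k : ℂ) + 1 + 1) ≠ 0 := by exact_mod_cast Nat.succ_ne_zero (2 * k + 1)
    push_cast
    rw [show c + ((k : ℂ) + 1) = c + k + 1 by ring]
    field_simp
    ring

theorem oo_rec (c : ℂ) (m k : ℕ) :
    oo c (m + 1) k = ee c m k + ((k : ℂ) + 1) ^ 2 * ee c m (k + 1) + (c + m) * oo c m k := by
  rcases lt_trichotomy m (2 * k) with h | h | h
  · have h1 : (m + 1).choose (2 * k + 1) = 0 := Nat.choose_eq_zero_of_lt (by omega)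
    have h2 : m.choose (2 * (k + 1)) = 0 := Nat.choose_eq_zero_of_lt (by omega)
    have h3 : m.choose (2 * k + 1) = 0 := Nat.choose_eq_zero_of_lt (by omega)
    have h4 : m.choose (2 * k) = 0 := Nat.choose_eq_zero_of_lt (by omega)
    rw [oo, if_neg (by omega), oo, if_neg (by omega)]
    simp [ee, h1, h2, h3, h4]
  · have h2 : m.choose (2 * (k + 1)) = 0 := Nat.choose_eq_zero_of_lt (by omega)
    have h3 : m.choose (2 * k + 1) = 0 := Nat.choose_eq_zero_of_lt (by omega)
    rw [oo, if_pos (by omega), oo, if_neg (by omega), ee, ee, h2, h3, h]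
    simp [poch]
  · obtain ⟨r, rfl⟩ := Nat.exists_eq_add_of_lt h
    rcases r with _ | r
    · have h2 : (2 * k + 0 + 1).choose (2 * (k + 1)) = 0 := Nat.choose_eq_zero_of_lt (by omega)
      rw [oo, if_neg (by omega), oo, if_pos (by omega), ee, ee, h2]
      have e1 : 2 * k + 0 + 1 + 1 - (2 * k + 2) = 0 := by omega
      have e2 : 2 * k + 0 + 1 - 2 * k = 1 := by omega
      rw [e1, e2, show 2 * k + 0 + 1 + 1 = (2 * k + 1) + 1 by ring, Nat.choose_succ_self_right,
        show 2 * k + 0 + 1 = (2 * k) + 1 by ring, Nat.choose_succ_self_right]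
      simp [poch]
      ring
    · have e1 : 2 * k + (r + 1) + 1 + 1 - (2 * k + 2) = r + 1 := by omega
      have e2 : 2 * k + (r + 1) + 1 - 2 * (k + 1) = r := by omega
      have e3 : 2 * k + (r + 1) + 1 - (2 * k + 2) = r := by omega
      have e5 : 2 * k + (r + 1) + 1 - 2 * k = (r + 1) + 1 := by omega
      have e4 : 2 * (k + 1) = 2 * k + 1 + 1 := by ring
      rw [ee, ee, oo, if_neg (by omega), oo, if_neg (by omega), e1, e2, e3, e5, e4,
        Nat.choose_succ_succ' (2 * k + (r + 1) + 1), poch_succ_left _ (r + 1), poch]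
      have c1 := choose_step (2 * k + (r + 1) + 1) (2 * k + 1) r (by ring)
      have c2 := choose_step (2 * k + (r + 1) + 1) (2 * k) (r + 1) (by ring)
      push_cast
      rw [c1, c2]
      have h1 : (2 * (k : ℂ) + 1 + 1) ≠ 0 := by exact_mod_cast Nat.succ_ne_zero (2 * k + 1)
      have h2 : (2 * (k : ℂ) + 1) ≠ 0 := by exact_mod_cast Nat.succ_ne_zero (2 * k)
      push_cast
      rw [show c + ((k : ℂ) + 1) = c + k + 1 by ring]
      field_simp
      ring

theorem sum_pp (a : ℂ) (e : ℕ → ℂ) (N : ℕ) :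
    ∑ k ∈ Finset.range (N + 1), e k * pp a k =
      ∑ k ∈ Finset.range N, (e k + ((k : ℂ) + 1) ^ 2 * e (k + 1)) * qq a k + e N * qq a N := by
  induction N with
  | zero => simp [pp, qq]
  | succ N ih =>
    rw [Finset.sum_range_succ, ih, Finset.sum_range_succ, pp_succ]; ring

theorem main_expansion (a c : ℂ) (m : ℕ) : ∀ N : ℕ, m ≤ 2 * N →
    poch (c - a) m = ∑ k ∈ Finset.range (N + 1), ee c m k * pp a k
      - a * ∑ k ∈ Finset.range N, oo c m k * qq a k := by
  induction m with
  | zero =>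
    intro N _
    have h0 : ∀ k, oo c 0 k = 0 := by
      intro k; simp [oo]
    have h1 : ∀ k, ee c 0 (k + 1) = 0 := by
      intro k; rw [ee, Nat.choose_eq_zero_of_lt (by omega)]; simp
    rw [Finset.sum_range_succ']
    simp only [h0, h1]
    simp [ee, pp, poch]
  | succ m ih =>
    intro N hN
    have hE : ∑ k ∈ Finset.range (N + 1), ee c (m + 1) k * pp a k =
        (c + m) * ∑ k ∈ Finset.range (N + 1), ee c m k * pp a k
        + a ^ 2 * ∑ k ∈ Finset.range N, oo c m k * qq a k := by
      rw [Finset.sum_range_succ', Finset.sum_range_succ' (fun k => ee c m k * pp a k), mul_add,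
        Finset.mul_sum, Finset.mul_sum, ee_rec_zero]
      rw [add_right_comm, ← Finset.sum_add_distrib]
      congr 1
      · apply Finset.sum_congr rfl
        intro k _
        rw [ee_rec, pp]; ring
      · ring
    have hO : ∑ k ∈ Finset.range N, oo c (m + 1) k * qq a k =
        ∑ k ∈ Finset.range (N + 1), ee c m k * pp a k
        + (c + m) * ∑ k ∈ Finset.range N, oo c m k * qq a k := by
      have hz : ee c m N = 0 := by
        rw [ee, Nat.choose_eq_zero_of_lt (by omega)]; simp
      rw [sum_pp, hz, zero_mul, add_zero, Finset.mul_sum, ← Finset.sum_add_distrib]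
      apply Finset.sum_congr rfl
      intro k _
      rw [oo_rec]; ring
    rw [poch, ih N (by omega), hE, hO]
    ring

theorem poch_ne_zero (x : ℂ) (k : ℕ) (h : ∀ j < k, x + (j : ℂ) ≠ 0) : poch x k ≠ 0 := by
  induction k with
  | zero => simp [poch]
  | succ k ih =>
    rw [poch]
    exact mul_ne_zero (ih fun j hj => h j (by omega)) (h k (by omega))

theorem poch_add (x : ℂ) (k l : ℕ) : poch x (k + l) = poch x k * poch (x + k) l := by
  induction l with
  | zero => simp [poch]
  | succ l ih => rw [← add_assoc, poch, ih, poch]; push_cast; ring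

theorem poch_a (a : ℂ) (k : ℕ) : poch a k * poch (-a) k = (-1) ^ k * pp a k := by
  induction k with
  | zero => simp [poch, pp]
  | succ k ih =>
    have : poch a (k + 1) * poch (-a) (k + 1) = (poch a k * poch (-a) k) * ((k : ℂ) ^ 2 - a ^ 2) := by
      rw [poch, poch]; ring
    rw [this, ih]
    cases k with
    | zero => simp [pp, qq]
    | succ k => simp only [pp, qq]; push_cast; ring

theorem poch_w (w : ℂ) (k : ℕ) : w * poch (1 + w) k = poch w k * (w + k) := by
  rw [add_comm 1 w, ← poch_succ_left, poch]

theorem poch_half (n k : ℕ) (hk : 2 * k ≤ n) :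
    poch (-(n : ℂ) / 2) k * poch ((1 - (n : ℂ)) / 2) k =
      n.choose (2 * k) * (poch (1 / 2) k * (Nat.factorial k : ℂ)) := by
  induction k with
  | zero => simp [poch]
  | succ k ih =>
    have ih := ih (by omega)
    obtain ⟨r, rfl⟩ := Nat.exists_eq_add_of_le hk
    have c1 := choose_step (2 * (k + 1) + r) (2 * k + 1) r (by ring)
    have c2 := choose_step (2 * (k + 1) + r) (2 * k) (r + 1) (by ring)
    have e4 : (2 * (k + 1) + r).choose (2 * (k + 1)) = (2 * (k + 1) + r).choose (2 * k + 1 + 1) := rfl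
    rw [poch, poch, mul_mul_mul_comm, ih, e4, c1, c2, poch, Nat.factorial_succ]
    have h1 : (2 * (k : ℂ) + 1 + 1) ≠ 0 := by exact_mod_cast Nat.succ_ne_zero (2 * k + 1)
    have h2 : (2 * (k : ℂ) + 1) ≠ 0 := by exact_mod_cast Nat.succ_ne_zero (2 * k)
    push_cast
    field_simp
    ring

theorem poch_refl (c : ℂ) (m k : ℕ) (hk : k ≤ m) :
    poch (1 - c - (m : ℂ)) k * poch c (m - k) = (-1) ^ k * poch c m := by
  induction k with
  | zero => simp [poch]
  | succ k ih =>
    have ih := ih (by omega)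
    obtain ⟨r, rfl⟩ := Nat.exists_eq_add_of_le hk
    have e1 : k + 1 + r - k = r + 1 := by omega
    have e2 : k + 1 + r - (k + 1) = r := by omega
    rw [e1, poch] at ih
    rw [e2, pow_succ, mul_right_comm, ← ih, poch]
    push_cast
    ring

theorem coef_lem (m k : ℕ) (hk : 2 * k + 2 ≤ m) (a c : ℂ) (ha : a ≠ 0) :
    ((m + 1).choose (2 * k + 2) : ℂ) *
      (1 - ((k : ℂ) + 1) * (2 * a + 2 * c + (m + 1) - 2) / (a * (m + 1))) =
    m.choose (2 * k + 2) - m.choose (2 * k + 1) * (c + ((m : ℂ) - 1) / 2) / a := by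
  obtain ⟨r, rfl⟩ := Nat.exists_eq_add_of_le hk
  have c1 := choose_step (2 * k + 2 + r) (2 * k + 1) r (by ring)
  have h1 : (2 * (k : ℂ) + 1 + 1) ≠ 0 := by exact_mod_cast Nat.succ_ne_zero (2 * k + 1)
  have h2 : (2 * ((k : ℂ) + 1) + r + 1) ≠ 0 := by
    have := Nat.succ_ne_zero (2 * (k + 1) + r)
    exact_mod_cast this
  rw [Nat.choose_succ_succ' (2 * k + 2 + r) (2 * k + 1)]
  push_cast
  rw [c1]
  push_cast
  field_simp
  ring

theorem term_lem (m k : ℕ) (hk : 2 * k + 2 ≤ m + 1) (a c : ℂ) (ha : a ≠ 0)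
    (hc : poch c (k + 1) ≠ 0) :
    ((m + 1).choose (2 * (k + 1)) : ℂ) *
      (1 - ((k : ℂ) + 1) * (2 * a + 2 * c + (m + 1) - 2) / (a * (m + 1))) *
      pp a (k + 1) * poch c (m - (k + 1)) / poch c (k + 1) =
    ee c m (k + 1) * pp a (k + 1) - a * (oo c m k * qq a k) := by
  have hm : (m : ℂ) + 1 ≠ 0 := by exact_mod_cast Nat.succ_ne_zero m
  rcases Nat.lt_or_ge m (2 * k + 2) with h | h
  · have hmk : m = 2 * k + 1 := by omega
    have h2 : m.choose (2 * (k + 1)) = 0 := Nat.choose_eq_zero_of_lt (by omega)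
    rw [oo, if_pos hmk, ee, h2]
    subst hmk
    have e : 2 * k + 1 - (k + 1) = k := by omega
    rw [poch] at hc
    have hc1 := left_ne_zero_of_mul hc
    have hc2 := right_ne_zero_of_mul hc
    rw [e, poch, show 2 * k + 1 + 1 = 2 * (k + 1) by ring, Nat.choose_self, pp]
    push_cast
    have hk1 : (k : ℂ) + 1 ≠ 0 := by exact_mod_cast Nat.succ_ne_zero k
    rw [show (2 * (k : ℂ) + 1 + 1) = 2 * (k + 1) by ring]
    field_simp
    ring
  · have key := coef_lem m k h a c ha
    rw [show 2 * (k + 1) = 2 * k + 2 by ring, key, ee, oo, if_neg (by omega)]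
    obtain ⟨r, rfl⟩ := Nat.exists_eq_add_of_le h
    have e1 : 2 * k + 2 + r - (k + 1) = (k + 1) + r := by omega
    have e2 : 2 * k + 2 + r - (2 * k + 2) = r := by omega
    have e3 : 2 * k + 2 + r - 2 * (k + 1) = r := by omega
    rw [e1, e2, e3, poch_add, pp, show 2 * (k + 1) = 2 * k + 2 by ring]
    push_cast
    rw [show c + ((k : ℂ) + 1) = c + k + 1 by ring]
    field_simp

/-- Terminating balanced ₅F₄-series identity (second-type CVG corollary, first form). -/
theorem cvg_balanced_5F4_first (n : ℕ) (hn : 1 ≤ n) (a c : ℂ) (w : ℂ)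
    (hw : w = -a * (n : ℂ) / (2 * a + 2 * c + (n : ℂ) - 2))
    (hden : 2 * a + 2 * c + (n : ℂ) - 2 ≠ 0)
    (ha : a ≠ 0)
    (hwj : ∀ j : ℕ, j < n / 2 → w + (j : ℂ) ≠ 0)
    (hc : ∀ j : ℕ, j < n - 1 → c + (j : ℂ) ≠ 0)
    (hcn : ∀ j : ℕ, j < n / 2 → 2 - c - (n : ℂ) + (j : ℂ) ≠ 0) :
    ∑ k ∈ Finset.range (n / 2 + 1),
      poch (-(n : ℂ) / 2) k * poch ((1 - (n : ℂ)) / 2) k * poch (1 + w) k *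
        poch a k * poch (-a) k /
        (poch (1 / 2) k * poch w k * poch c k * poch (2 - c - (n : ℂ)) k *
          (Nat.factorial k : ℂ)) =
      poch (c - a) (n - 1) / poch c (n - 1) := by

  obtain ⟨m, rfl⟩ : ∃ m, n = m + 1 := ⟨n - 1, by omega⟩
  have hm : (m : ℂ) + 1 ≠ 0 := by exact_mod_cast Nat.succ_ne_zero m
  push_cast at hw hden
  have hw0 : w ≠ 0 := by
    rw [hw]; exact div_ne_zero (mul_ne_zero (neg_ne_zero.mpr ha) hm) hden
  have hcm : poch c m ≠ 0 := poch_ne_zero _ _ (fun j hj => hc j (by omega))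
  have hterm : ∀ k, 2 * k ≤ m + 1 →
      poch (-((m + 1 : ℕ) : ℂ) / 2) k * poch ((1 - ((m + 1 : ℕ) : ℂ)) / 2) k * poch (1 + w) k *
        poch a k * poch (-a) k /
        (poch (1 / 2) k * poch w k * poch c k * poch (2 - c - ((m + 1 : ℕ) : ℂ)) k *
          (Nat.factorial k : ℂ)) =
      (((m + 1).choose (2 * k) : ℂ) *
      (1 - (k : ℂ) * (2 * a + 2 * c + (m + 1) - 2) / (a * (m + 1))) *
      pp a k * poch c (m - k) / poch c k) / poch c m := by
    intro k hk
    have hhalf : poch (1 / 2) k ≠ 0 := by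
      apply poch_ne_zero
      intro j _ h
      have h2 : (1 : ℂ) + 2 * j = 0 := by linear_combination 2 * h
      have h3 : ((1 + 2 * j : ℕ) : ℂ) = 0 := by push_cast; exact h2
      have := Nat.cast_eq_zero.mp h3
      omega
    have hf : (Nat.factorial k : ℂ) ≠ 0 := by exact_mod_cast Nat.factorial_ne_zero k
    have hwk : poch w k ≠ 0 := poch_ne_zero _ _ (fun j hj => hwj j (by omega))
    have hck : poch c k ≠ 0 := poch_ne_zero _ _ (fun j hj => hc j (by omega))
    have hdk : poch (2 - c - ((m + 1 : ℕ) : ℂ)) k ≠ 0 :=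
      poch_ne_zero _ _ (fun j hj => hcn j (by omega))
    have e1 := poch_refl c m k (by omega)
    rw [show 1 - c - (m : ℂ) = 2 - c - ((m + 1 : ℕ) : ℂ) by push_cast; ring] at e1
    have e2 := poch_half (m + 1) k hk
    have e3 := poch_a a k
    have e4 := poch_w w k
    have e5 : 1 - (k : ℂ) * (2 * a + 2 * c + (m + 1) - 2) / (a * (m + 1)) = (w + k) / w := by
      have : w⁻¹ = - ((2 * a + 2 * c + (m + 1) - 2) / (a * (m + 1))) := by
        rw [hw, inv_div, neg_mul, div_neg]
      rw [add_div, div_self hw0, div_eq_mul_inv (k : ℂ) w, this]; ring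
    rw [e5]
    have e6 : poch (1 + w) k = poch w k * (w + k) / w := by
      field_simp; linear_combination e4
    have hs : ((-1 : ℂ) ^ k) * (-1) ^ k = 1 := by
      rw [← mul_pow]; simp
    rw [e2, e6, mul_assoc _ (poch a k), e3, div_div, div_eq_div_iff (by positivity) (by positivity)]
    generalize poch (2 - c - ((m + 1 : ℕ) : ℂ)) k = D at *
    have e7 : poch c m = (-1) ^ k * (D * poch c (m - k)) := by
      rw [e1, ← mul_assoc, hs, one_mul]
    rw [e7]
    field_simp
    have hs2 : ((-1 : ℂ) ^ k) ^ 2 = 1 := by rw [sq, hs]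
    linear_combination (((m + 1).choose (2 * k) : ℂ) * (w + k) * pp a k * poch c (m - k)) * hs2
  rw [Finset.sum_congr rfl (fun k hk => hterm k (by have := Finset.mem_range.mp hk; omega)),
    ← Finset.sum_div]
  congr 1
  rw [show m + 1 - 1 = m by omega, main_expansion a c m ((m + 1) / 2) (by omega),
    Finset.sum_range_succ', Finset.sum_range_succ' (fun k => ee c m k * pp a k), Finset.mul_sum,
    add_sub_right_comm (∑ k ∈ Finset.range ((m + 1) / 2), ee c m (k + 1) * pp a (k + 1)), ← Finset.sum_sub_distrib]
  congr 1
  · apply Finset.sum_congr rfl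
    intro k hk
    have hk' := Finset.mem_range.mp hk
    rw [← term_lem m k (by omega) a c ha (poch_ne_zero _ _ (fun j hj => hc j (by omega)))]
    push_cast
    rfl
  · simp [ee, pp, poch]
end

section
/- Let n be a nonnegative integer and let a, c ∈ ℂ satisfy c + j ≠ 0 for 0 ≤ j ≤ n−1 and c−a+n+j ≠ 0 for 0 ≤ j ≤ ⌊(n+1)/2⌋−1. Then (c−a)_n/(c)_n = Σ_{k=0}^{⌊n/2⌋} C(n,2k) (−1)^k (1−a)_k (c−a)_k (a)_k / ((c−a+n)_k (c)_{2k}) − Σ_{0 ≤ 2k+1 ≤ n} C(n,2k+1) (−1)^k (1+c−a+3k) (1−a)_k (c−a)_k (a)_{k+1} / ((c−a+n)_{k+1} (c)_{2k+1}). (Third-type reciprocal relation dual to the Chu–Vandermonde–Gauß summation formula, first form.) -/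
theorem poch_zero' (x : ℂ) : poch x 0 = 1 := rfl
theorem poch_succ' (x : ℂ) (m : ℕ) : poch x (m + 1) = poch x m * (x + (m : ℂ)) := rfl

theorem poch_ne (x : ℂ) (m : ℕ) (h : ∀ j : ℕ, j < m → x + (j : ℂ) ≠ 0) : poch x m ≠ 0 := by
  induction m with
  | zero => simp [poch_zero']
  | succ m ih =>
    rw [poch_succ']
    exact mul_ne_zero (ih fun j hj => h j (by omega)) (h m (by omega))

theorem poch_cont (m : ℕ) : Continuous fun x : ℂ => poch x m := by
  induction m with
  | zero => simp only [poch_zero']; exact continuous_const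
  | succ m ih =>
    simp only [poch_succ']
    exact ih.mul (by fun_prop)

theorem poch_shift (x : ℂ) (m : ℕ) : x * poch (x + 1) m = poch x m * (x + (m : ℂ)) := by
  induction m with
  | zero => simp [poch_zero']
  | succ m ih =>
    rw [poch_succ', poch_succ', ← mul_assoc, ih]
    push_cast; ring

/-- even-index summand -/
noncomputable def tE (a c : ℂ) (n k : ℕ) : ℂ :=
  (n.choose (2 * k) : ℂ) * ((-1 : ℂ) ^ k * poch (1 - a) k * poch (c - a) k * poch a k) /
          (poch (c - a + (n : ℂ)) k * poch c (2 * k))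

/-- odd-index summand -/
noncomputable def tO (a c : ℂ) (n k : ℕ) : ℂ :=
  (n.choose (2 * k + 1) : ℂ) *
          ((-1 : ℂ) ^ k * (1 + c - a + 3 * (k : ℂ)) * poch (1 - a) k * poch (c - a) k *
            poch a (k + 1)) /
          (poch (c - a + (n : ℂ)) (k + 1) * poch c (2 * k + 1))

/-- telescoping certificate -/
noncomputable def tH (a c : ℂ) (n k : ℕ) : ℂ :=
  (n.choose (2 * k + 1) : ℂ) *
          ((-1 : ℂ) ^ k * poch (1 - a) (k + 1) * poch (c - a) (k + 1) *
            poch a (k + 1)) * (c - a + n) /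
          (poch (c - a + (n : ℂ)) (k + 2) * poch c (2 * k + 1))

theorem choose_cast (n m : ℕ) :
    (n.choose (m + 1) : ℂ) = ((n : ℂ) - m) * n.choose m / ((m : ℂ) + 1) := by
  have hm : (m : ℂ) + 1 ≠ 0 := by exact_mod_cast Nat.succ_ne_zero m
  rw [eq_div_iff hm]
  rcases le_or_gt m n with h | h
  · have := Nat.choose_succ_right_eq n m
    have h2 := congrArg (Nat.cast : ℕ → ℂ) this
    push_cast [Nat.cast_sub h] at h2
    rw [h2]; ring
  · rw [Nat.choose_eq_zero_of_lt h, Nat.choose_eq_zero_of_lt (by omega)]; simp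

theorem tele_zero (a c : ℂ) (n : ℕ) (hc : ∀ j : ℕ, c + (j : ℂ) ≠ 0)
    (hb : ∀ j : ℕ, c - a + (j : ℂ) ≠ 0) :
    (c + n) * (tE a c (n + 1) 0 - tO a c (n + 1) 0) -
      (c - a + n) * (tE a c n 0 - tO a c n 0) = tH a c n 0 := by
  have h0 : c ≠ 0 := by simpa using hc 0
  have h1 := hb n
  have h2 : c - a + n + 1 ≠ 0 := by have := hb (n + 1); push_cast at this; rwa [← add_assoc] at this
  simp only [tE, tO, tH, poch_succ', poch_zero']
  simp
  have h2' : c - a + (n + 1) ≠ 0 := by rwa [← add_assoc]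
  field_simp
  ring

theorem tele_succ (a c : ℂ) (n k : ℕ) (hc : ∀ j : ℕ, c + (j : ℂ) ≠ 0)
    (hb : ∀ j : ℕ, c - a + (j : ℂ) ≠ 0) :
    (c + n) * (tE a c (n + 1) (k + 1) - tO a c (n + 1) (k + 1)) -
      (c - a + n) * (tE a c n (k + 1) - tO a c n (k + 1)) = tH a c n (k + 1) - tH a c n k := by
  have hn := hb n
  have hQ : poch (c - a + n) k ≠ 0 := poch_ne _ _ fun j _ => by
    have := hb (n + j); push_cast at this; rwa [← add_assoc] at this
  have hR : poch c (2 * k) ≠ 0 := poch_ne _ _ fun j _ => hc j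
  have hs : poch (c - a + ((n + 1 : ℕ) : ℂ)) k
      = poch (c - a + n) k * (c - a + n + k) / (c - a + n) := by
    rw [eq_div_iff hn, ← poch_shift, mul_comm]; push_cast; rw [add_assoc]
  have e1 : 2 * (k + 1) = 2 * k + 1 + 1 := by ring
  have c0 := hc (2 * k)
  have c1 := hc (2 * k + 1)
  have c2 := hc (2 * k + 2)
  have b0 := hb (n + k)
  have b1 := hb (n + k + 1)
  have b2 := hb (n + k + 2)
  have m1 : (2 * (k : ℂ) + 2) ≠ 0 := by exact_mod_cast Nat.succ_ne_zero (2 * k + 1)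
  have m2 : (2 * (k : ℂ) + 3) ≠ 0 := by exact_mod_cast Nat.succ_ne_zero (2 * k + 2)
  have y : (n.choose (2 * k + 1 + 1) : ℂ)
      = ((n : ℂ) - 2 * k - 1) * n.choose (2 * k + 1) / (2 * (k : ℂ) + 2) := by
    rw [choose_cast]; push_cast; congr 1 <;> ring
  have z : (n.choose (2 * k + 1 + 1 + 1) : ℂ)
      = ((n : ℂ) - 2 * k - 2) * (((n : ℂ) - 2 * k - 1) * n.choose (2 * k + 1) / (2 * (k : ℂ) + 2))
        / (2 * (k : ℂ) + 3) := by
    rw [choose_cast, y]; push_cast; congr 1 <;> ring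
  simp only [tE, tO, tH, e1, Nat.choose_succ_succ n (2 * k + 1), Nat.choose_succ_succ n (2 * k + 1 + 1), poch_succ', hs,
    Nat.succ_eq_add_one, pow_succ]
  simp only [Nat.cast_add _ (n.choose _), y, z]
  push_cast at *
  generalize poch (c - a + n) k = Q at *
  generalize poch c (2 * k) = R at *
  generalize poch (1 - a) k = A1
  generalize poch (c - a) k = A2
  generalize poch a k = A3
  generalize (n.choose (2 * k + 1) : ℂ) = X
  generalize (-1 : ℂ) ^ k = s
  generalize (n : ℂ) = N at *
  generalize (k : ℂ) = K at *
  have b0' : c - a + N + K ≠ 0 := by convert b0 using 1; ring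
  have b1' : c - a + N + (K + 1) ≠ 0 := by convert b1 using 1; ring
  have b1'' : c - a + (N + 1) + K ≠ 0 := by convert b1 using 1; ring
  have b2' : c - a + (N + 1) + (K + 1) ≠ 0 := by convert b2 using 1; ring
  have b2'' : c - a + N + (K + 1 + 1) ≠ 0 := by convert b2 using 1; ring
  have c2' : c + (2 * K + 1 + 1) ≠ 0 := by convert c2 using 1; ring
  have r1 : c - a + (N + 1) + K = c - a + N + (K + 1) := by ring
  have r2 : c - a + (N + 1) + (K + 1) = c - a + N + (K + 1 + 1) := by ring
  have r3 : K + 1 + 1 = K + 2 := by ring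
  have m0 : K + 1 ≠ 0 := by intro h; apply m1; linear_combination 2 * h
  have c3 : c + 2 * (K + 1) ≠ 0 := by convert c2 using 1; ring
  have b3 : c - a + N + (K + 2) ≠ 0 := by convert b2 using 1; ring
  have r4 : 2 * K + 2 = 2 * (K + 1) := by ring
  have r5 : c + (2 * K + 1 + 1) = c + 2 * (K + 1) := by ring
  rw [r1, r2]
  simp only [r3, r4, r5]
  field_simp
  ring

theorem tele_sum (a c : ℂ) (n N : ℕ) (hc : ∀ j : ℕ, c + (j : ℂ) ≠ 0)
    (hb : ∀ j : ℕ, c - a + (j : ℂ) ≠ 0) :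
    ∑ k ∈ Finset.range (N + 1), ((c + n) * (tE a c (n + 1) k - tO a c (n + 1) k) -
      (c - a + n) * (tE a c n k - tO a c n k)) = tH a c n N := by
  induction N with
  | zero => simpa using tele_zero a c n hc hb
  | succ N ih => rw [Finset.sum_range_succ, ih, tele_succ a c n N hc hb]; ring

theorem gen_sum (a c : ℂ) (hc : ∀ j : ℕ, c + (j : ℂ) ≠ 0)
    (hb : ∀ j : ℕ, c - a + (j : ℂ) ≠ 0) (n : ℕ) : ∀ N, n ≤ N →
    ∑ k ∈ Finset.range (N + 1), (tE a c n k - tO a c n k) = poch (c - a) n / poch c n := by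
  induction n with
  | zero =>
    intro N _
    rw [Finset.sum_range_succ', Finset.sum_eq_zero]
    · simp [tE, tO, poch_zero']
    · intro k _
      simp [tE, tO, Nat.choose_eq_zero_of_lt, mul_add]
  | succ n ih =>
    intro N hN
    have h := tele_sum a c n N hc hb
    rw [Finset.sum_sub_distrib, ← Finset.mul_sum, ← Finset.mul_sum, ih N (by omega)] at h
    have h0 : tH a c n N = 0 := by
      simp [tH, Nat.choose_eq_zero_of_lt (show n < 2 * N + 1 by omega)]
    rw [h0, sub_eq_zero] at h
    have hp : poch c n ≠ 0 := poch_ne _ _ fun j _ => hc j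
    have hcn := hc n
    apply mul_left_cancel₀ hcn
    rw [h, poch_succ', poch_succ']
    field_simp

theorem gen_main (a c : ℂ) (hc : ∀ j : ℕ, c + (j : ℂ) ≠ 0)
    (hb : ∀ j : ℕ, c - a + (j : ℂ) ≠ 0) (n : ℕ) :
    poch (c - a) n / poch c n = (∑ k ∈ Finset.range (n / 2 + 1), tE a c n k) -
      ∑ k ∈ Finset.range ((n + 1) / 2), tO a c n k := by
  rw [← gen_sum a c hc hb n n le_rfl, Finset.sum_sub_distrib]
  congr 1
  · symm
    apply Finset.sum_subset
    · intro k; simp only [Finset.mem_range]; omega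
    · intro k _ hk
      simp only [Finset.mem_range] at hk
      simp [tE, Nat.choose_eq_zero_of_lt (show n < 2 * k by omega)]
  · symm
    apply Finset.sum_subset
    · intro k; simp only [Finset.mem_range]; omega
    · intro k _ hk
      simp only [Finset.mem_range] at hk
      simp [tO, Nat.choose_eq_zero_of_lt (show n < 2 * k + 1 by omega)]

theorem dense_good (a : ℂ) :
    Dense {c : ℂ | (∀ j : ℕ, c + (j : ℂ) ≠ 0) ∧ ∀ j : ℕ, c - a + (j : ℂ) ≠ 0} := by
  have h1 : (Set.range (fun j : ℕ => -(j : ℂ)) ∪ Set.range (fun j : ℕ => a - (j : ℂ))).Countable :=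
    (Set.countable_range _).union (Set.countable_range _)
  refine (h1.dense_compl ℂ).mono ?_
  intro c hc
  simp only [Set.mem_compl_iff, Set.mem_union, Set.mem_range, not_or, not_exists] at hc
  refine ⟨fun j h => hc.1 j ?_, fun j h => hc.2 j ?_⟩
  · linear_combination -h
  · linear_combination -h

/-- Third-type reciprocal relation dual to the Chu–Vandermonde–Gauß summation formula,
first form. -/
theorem cvg_reciprocal_third_first (n : ℕ) (a c : ℂ)
    (hc : ∀ j : ℕ, j < n → c + (j : ℂ) ≠ 0)
    (hca : ∀ j : ℕ, j < (n + 1) / 2 → c - a + (n : ℂ) + (j : ℂ) ≠ 0) :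
    poch (c - a) n / poch c n =
      (∑ k ∈ Finset.range (n / 2 + 1),
        (n.choose (2 * k) : ℂ) * ((-1 : ℂ) ^ k * poch (1 - a) k * poch (c - a) k * poch a k) /
          (poch (c - a + (n : ℂ)) k * poch c (2 * k))) -
      ∑ k ∈ Finset.range ((n + 1) / 2),
        (n.choose (2 * k + 1) : ℂ) *
          ((-1 : ℂ) ^ k * (1 + c - a + 3 * (k : ℂ)) * poch (1 - a) k * poch (c - a) k *
            poch a (k + 1)) /
          (poch (c - a + (n : ℂ)) (k + 1) * poch c (2 * k + 1)) := by
  have hcp : ∀ m, m ≤ n → poch c m ≠ 0 := fun m hm => poch_ne _ _ fun j hj => hc j (by omega)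
  have hbp : ∀ m, m ≤ (n + 1) / 2 → poch (c - a + (n : ℂ)) m ≠ 0 :=
    fun m hm => poch_ne _ _ fun j hj => hca j (by omega)
  have k1 : ∀ m, ContinuousAt (fun x : ℂ => poch x m) c := fun m => (poch_cont m).continuousAt
  have k2 : ∀ m, ContinuousAt (fun x : ℂ => poch (x - a) m) c := fun m =>
    ((poch_cont m).comp (by fun_prop : Continuous fun x : ℂ => x - a)).continuousAt
  have k3 : ∀ m, ContinuousAt (fun x : ℂ => poch (x - a + (n : ℂ)) m) c := fun m =>
    ((poch_cont m).comp (by fun_prop : Continuous fun x : ℂ => x - a + (n : ℂ))).continuousAt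
  have hL : ContinuousAt (fun x : ℂ => poch (x - a) n / poch x n) c :=
    (k2 n).div (k1 n) (hcp n le_rfl)
  have hE : ∀ k ∈ Finset.range (n / 2 + 1), ContinuousAt (fun x : ℂ => tE a x n k) c := by
    intro k hk
    rw [Finset.mem_range] at hk
    unfold tE
    refine ContinuousAt.div ?_ ((k3 k).mul (k1 _))
      (mul_ne_zero (hbp _ (by omega)) (hcp _ (by omega)))
    have := k2 k
    fun_prop
  have hO : ∀ k ∈ Finset.range ((n + 1) / 2), ContinuousAt (fun x : ℂ => tO a x n k) c := by
    intro k hk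
    rw [Finset.mem_range] at hk
    unfold tO
    refine ContinuousAt.div ?_ ((k3 _).mul (k1 _))
      (mul_ne_zero (hbp _ (by omega)) (hcp _ (by omega)))
    have := k2 k
    fun_prop
  have hR : ContinuousAt (fun x : ℂ => (∑ k ∈ Finset.range (n / 2 + 1), tE a x n k) -
      ∑ k ∈ Finset.range ((n + 1) / 2), tO a x n k) c :=
    (tendsto_finsetSum _ hE).sub (tendsto_finsetSum _ hO)
  have hne : (nhdsWithin c {c : ℂ | (∀ j : ℕ, c + (j : ℂ) ≠ 0) ∧
      ∀ j : ℕ, c - a + (j : ℂ) ≠ 0}).NeBot := mem_closure_iff_nhdsWithin_neBot.mp (dense_good a c)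
  have hL' := hL.continuousWithinAt (s := {c : ℂ | (∀ j : ℕ, c + (j : ℂ) ≠ 0) ∧
      ∀ j : ℕ, c - a + (j : ℂ) ≠ 0})
  have hR' := hR.continuousWithinAt (s := {c : ℂ | (∀ j : ℕ, c + (j : ℂ) ≠ 0) ∧
      ∀ j : ℕ, c - a + (j : ℂ) ≠ 0})
  refine tendsto_nhds_unique (Filter.Tendsto.congr' ?_ hL') hR'
  filter_upwards [self_mem_nhdsWithin] with x hx
  exact gen_main a x hx.1 hx.2 n
end
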